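/- Let p be a prime and n a positive natural number. The number of join-irreducible elements of the lattice Sat(Sub(C_p^n)) of saturated transfer systems on the subgroup lattice of the elementary abelian group C_p^n equals ((p^n − 1)/(p − 1)) · a_{n−1,p}, where a_{m,p} denotes the total number of subspaces of the 𝔽_p-vector space 𝔽_p^m. -/

import Mathlib

/-- A transfer system on a lattice `L`: a reflexive, transitive binary relation refining `≤`
which is closed under restriction. -/
def IsTransferSystem {L : Type*} [Lattice L] (T : Set (L × L)) : Prop :=
  (∀ x : L, (x, x) ∈ T) ∧
  (∀ x y z : L, (x, y) ∈ T → (y, z) ∈ T → (x, z) ∈ T) ∧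
  (∀ x y : L, (x, y) ∈ T → x ≤ y) ∧
  (∀ x y z : L, (x, y) ∈ T → z ≤ y → (x ⊓ z, z) ∈ T)

/-- A saturated transfer system: a transfer system satisfying 2-out-of-3. -/
def IsSaturatedTS {L : Type*} [Lattice L] (T : Set (L × L)) : Prop :=
  IsTransferSystem T ∧ ∀ x y z : L, x ≤ y → y ≤ z → (x, z) ∈ T → (y, z) ∈ T

/-- A cotransfer system on a lattice `L`: a reflexive, transitive binary relation refining `≤`
which is closed under corestriction. -/
def IsCotransferSystem {L : Type*} [Lattice L] (T : Set (L × L)) : Prop :=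
  (∀ x : L, (x, x) ∈ T) ∧
  (∀ x y z : L, (x, y) ∈ T → (y, z) ∈ T → (x, z) ∈ T) ∧
  (∀ x y : L, (x, y) ∈ T → x ≤ y) ∧
  (∀ x y z : L, (x, y) ∈ T → x ≤ z → (z, y ⊔ z) ∈ T)

/-- `⌊x → y⌋`, the smallest transfer system containing the pair `(x, y)`. -/
def tsGen {L : Type*} [Lattice L] (x y : L) : Set (L × L) :=
  ⋂₀ {T | IsTransferSystem T ∧ (x, y) ∈ T}

/-- `⌈x → y⌉`, the smallest cotransfer system containing the pair `(x, y)`. -/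
def ctsGen {L : Type*} [Lattice L] (x y : L) : Set (L × L) :=
  ⋂₀ {T | IsCotransferSystem T ∧ (x, y) ∈ T}

/-- The smallest saturated transfer system containing a set `S` of pairs. -/
def satGen {L : Type*} [Lattice L] (S : Set (L × L)) : Set (L × L) :=
  ⋂₀ {T | IsSaturatedTS T ∧ S ⊆ T}

/-- The right lifting class `X^⧄` of a set `X` of pairs. -/
def rlc {L : Type*} [Lattice L] (X : Set (L × L)) : Set (L × L) :=
  {g | g.1 ≤ g.2 ∧ ∀ f ∈ X, f.1 ≤ g.1 → f.2 ≤ g.2 → f.2 ≤ g.1}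

/-- `T` is a join-irreducible element of the lattice `Sat(L)` of saturated transfer systems:
it is not the minimum (the diagonal), and whenever it is the join (in `Sat(L)`, i.e. the
saturated transfer system generated by the union) of two saturated transfer systems, it equals
one of them. -/
def JoinIrredSat {L : Type*} [Lattice L] (T : Set (L × L)) : Prop :=
  T ≠ {p : L × L | p.1 = p.2} ∧
  ∀ S₁ S₂ : Set (L × L), IsSaturatedTS S₁ → IsSaturatedTS S₂ →
    T = satGen (S₁ ∪ S₂) → T = S₁ ∨ T = S₂

/-- `T` is a meet-irreducible element of the lattice `Sat(L)` of saturated transfer systems: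
it is not the maximum (the full order relation), and whenever it is the meet (intersection)
of two saturated transfer systems, it equals one of them. -/
def MeetIrredSat {L : Type*} [Lattice L] (T : Set (L × L)) : Prop :=
  T ≠ {p : L × L | p.1 ≤ p.2} ∧
  ∀ S₁ S₂ : Set (L × L), IsSaturatedTS S₁ → IsSaturatedTS S₂ →
    T = S₁ ∩ S₂ → T = S₁ ∨ T = S₂

/-- `a_{m,p}`: the number of subspaces of the `𝔽_p`-vector space `𝔽_p^m`. -/
noncomputable def numSubspaces (p m : ℕ) : ℕ :=
  Nat.card (Submodule (ZMod p) (Fin m → ZMod p))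

section PrincipalSaturated

variable {L : Type*} [Lattice L]

/-- The saturated transfer system generated by a covering pair `x ⋖ y` of a modular lattice. -/
def coverSat (x y : L) : Set (L × L) :=
  {q | q.1 = q.2 ∨ (q.2 ≤ y ∧ q.1 = x ⊓ q.2)}

theorem mem_coverSat {x y : L} (h : x ≤ y) : (x, y) ∈ coverSat x y :=
  Or.inr ⟨le_rfl, (inf_eq_left.2 h).symm⟩

theorem coverSat_subset {x y : L} {T : Set (L × L)} (hT : IsTransferSystem T)
    (h : (x, y) ∈ T) : coverSat x y ⊆ T := by
  rintro ⟨a, b⟩ (hab | ⟨hb, hab⟩)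
  · obtain rfl : a = b := hab
    exact hT.1 a
  · obtain rfl : a = x ⊓ b := hab
    exact hT.2.2.2 x y b h hb

theorem eq_of_mem_coverSat_self {x y b : L} (h : x ≤ y) (hb : (b, y) ∈ coverSat x y) :
    b = y ∨ b = x := by
  rcases hb with hb | ⟨-, hb⟩
  · exact Or.inl hb
  · exact Or.inr (hb.trans (inf_eq_left.2 h))

theorem inf_covBy_of_covBy_of_le [IsModularLattice L] {x y z : L} (h : x ⋖ y) (hz : z ≤ y)
    (hzx : ¬ z ≤ x) : x ⊓ z ⋖ z := by
  have hsup : x ⊔ z = y := by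
    refine (h.eq_or_eq le_sup_left (sup_le h.le hz)).resolve_left fun e => hzx ?_
    exact e ▸ le_sup_right
  exact IsLowerModularLattice.inf_covBy_of_covBy_sup (hsup.symm ▸ h)

theorem eq_or_covBy_of_mem_coverSat [IsModularLattice L] {x y : L} (h : x ⋖ y) {a b : L}
    (hab : (a, b) ∈ coverSat x y) : a = b ∨ a ⋖ b := by
  rcases hab with hab | ⟨hb, hab⟩
  · exact Or.inl hab
  · obtain rfl : a = x ⊓ b := hab
    by_cases hbx : b ≤ x
    · exact Or.inl (inf_eq_right.2 hbx)
    · exact Or.inr (inf_covBy_of_covBy_of_le h hb hbx)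

theorem trans_coverSat {x y a b c : L} (hab : (a, b) ∈ coverSat x y)
    (hbc : (b, c) ∈ coverSat x y) : a = b ∨ b = c := by
  rcases hab with hab | ⟨-, hab⟩
  · exact Or.inl hab
  rcases hbc with hbc | ⟨-, hbc⟩
  · exact Or.inr hbc
  · left
    simp only at hab hbc
    rw [hab, inf_eq_right, hbc]
    exact inf_le_left

theorem isSaturatedTS_coverSat [IsModularLattice L] {x y : L} (h : x ⋖ y) :
    IsSaturatedTS (coverSat x y) := by
  refine ⟨⟨fun _ => Or.inl rfl, ?_, ?_, ?_⟩, ?_⟩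
  · intro a b c hab hbc
    rcases trans_coverSat hab hbc with rfl | rfl
    exacts [hbc, hab]
  · intro a b hab
    rcases eq_or_covBy_of_mem_coverSat h hab with rfl | hc
    exacts [le_rfl, hc.le]
  · rintro a b z (hab | ⟨hb, hab⟩) hz
    · obtain rfl : a = b := hab
      exact Or.inl (inf_eq_right.2 hz)
    · obtain rfl : a = x ⊓ b := hab
      refine Or.inr ⟨hz.trans hb, ?_⟩
      simp only [inf_assoc, inf_eq_right.2 hz]
  · intro a b c hab hbc hac
    rcases eq_or_covBy_of_mem_coverSat h hac with rfl | hc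
    · exact Or.inl (le_antisymm hbc hab)
    · rcases hc.eq_or_eq hab hbc with rfl | rfl
      exacts [hac, Or.inl rfl]

theorem isSaturatedTS_coverSat_diff [IsModularLattice L] {x y : L} (h : x ⋖ y) :
    IsSaturatedTS (coverSat x y \ {(x, y)}) := by
  have H := isSaturatedTS_coverSat h
  have hdiag : ∀ a : L, (a, a) ∈ coverSat x y \ {(x, y)} := fun a =>
    ⟨Or.inl rfl, fun e => h.ne (by
      have := Prod.mk.inj (Set.mem_singleton_iff.1 e)
      rw [← this.1, ← this.2])⟩
  refine ⟨⟨hdiag, ?_, fun a b hab => H.1.2.2.1 a b hab.1, ?_⟩, ?_⟩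
  · intro a b c hab hbc
    rcases trans_coverSat hab.1 hbc.1 with rfl | rfl
    exacts [hbc, hab]
  · intro a b z hab hz
    have hle := H.1.2.2.1 a b hab.1
    refine ⟨H.1.2.2.2 a b z hab.1 hz, fun e => ?_⟩
    obtain ⟨e₁, rfl⟩ := Prod.mk.inj (Set.mem_singleton_iff.1 e)
    rcases hab.1 with hab' | ⟨hb, -⟩
    · obtain rfl : a = b := hab'
      exact h.ne (e₁.symm.trans (inf_eq_right.2 hz))
    · obtain rfl : b = z := le_antisymm hb hz
      exact hab.2 (by rw [← e₁, inf_eq_left.2 hle]; rfl)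
  · intro a b c hab hbc hac
    rcases eq_or_covBy_of_mem_coverSat h hac.1 with rfl | hc
    · obtain rfl := le_antisymm hbc hab
      exact hac
    · rcases hc.eq_or_eq hab hbc with rfl | rfl
      exacts [hac, hdiag _]

theorem satGen_subset {S T : Set (L × L)} (hT : IsSaturatedTS T) (h : S ⊆ T) : satGen S ⊆ T :=
  Set.sInter_subset_of_mem ⟨hT, h⟩

theorem subset_satGen (S : Set (L × L)) : S ⊆ satGen S :=
  Set.subset_sInter fun _ h => h.2

theorem isSaturatedTS_satGen {S T : Set (L × L)} (hT : IsSaturatedTS T) (h : S ⊆ T) :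
    IsSaturatedTS (satGen S) := by
  refine ⟨⟨?_, ?_, ?_, ?_⟩, ?_⟩
  · exact fun a U hU => hU.1.1.1 a
  · exact fun a b c hab hbc U hU => hU.1.1.2.1 a b c (hab U hU) (hbc U hU)
  · exact fun a b hab => hT.1.2.2.1 a b (hab T ⟨hT, h⟩)
  · exact fun a b z hab hz U hU => hU.1.1.2.2.2 a b z (hab U hU) hz
  · exact fun a b c hab hbc hac U hU => hU.1.2 a b c hab hbc (hac U hU)

theorem joinIrredSat_coverSat [IsModularLattice L] {x y : L} (h : x ⋖ y) :
    JoinIrredSat (coverSat x y) := by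
  refine ⟨fun e => ?_, fun S₁ S₂ h₁ h₂ hT => ?_⟩
  · have := mem_coverSat h.le
    rw [e] at this
    exact h.ne this
  · have hsub : S₁ ∪ S₂ ⊆ coverSat x y := hT ▸ subset_satGen _
    have hmem : (x, y) ∈ S₁ ∪ S₂ := by
      by_contra hn
      have := satGen_subset (isSaturatedTS_coverSat_diff h)
        (fun q hq => ⟨hsub hq, fun e => hn (Set.mem_singleton_iff.1 e ▸ hq)⟩)
      rw [← hT] at this
      exact (this (mem_coverSat h.le)).2 rfl
    rcases hmem with hm | hm
    · exact Or.inl ((coverSat_subset h₁.1 hm).antisymm (Set.subset_union_left.trans hsub))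
    · exact Or.inr ((coverSat_subset h₂.1 hm).antisymm (Set.subset_union_right.trans hsub))

theorem mem_of_forall_covBy_mem [Finite L] {S T : Set (L × L)} (hS : IsSaturatedTS S)
    (hT : IsSaturatedTS T) (h : ∀ a b, a ⋖ b → (a, b) ∈ T → (a, b) ∈ S) : T ⊆ S := by
  rintro ⟨a, b⟩ hab
  induction a using WellFoundedGT.induction with
  | ind a ih =>
    rcases (hT.1.2.2.1 a b hab).eq_or_lt with rfl | hlt
    · exact hS.1.1 a
    · obtain ⟨c, hac, hcb⟩ := exists_covBy_le_of_lt hlt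
      have hac' : (a, c) ∈ T := by
        simpa [inf_eq_left.2 hac.le] using hT.1.2.2.2 a b c hab hcb
      exact hS.1.2.1 a c b (h a c hac hac') (ih c hac.lt (hT.2 a c b hac.le hcb hab))

theorem exists_eq_coverSat_of_joinIrredSat [Finite L] [IsModularLattice L] {T : Set (L × L)}
    (hT : IsSaturatedTS T) (hJ : JoinIrredSat T) : ∃ x y, x ⋖ y ∧ T = coverSat x y := by
  classical
  have key : ∀ F : Finset (L × L), (∀ q ∈ F, q.1 ⋖ q.2 ∧ q ∈ T) →
      T = satGen (F : Set (L × L)) → ∃ x y, x ⋖ y ∧ T = coverSat x y := by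
    intro F
    induction F using Finset.induction_on with
    | empty =>
      intro _ hF
      refine absurd (Set.Subset.antisymm ?_ ?_) hJ.1
      · rw [hF]
        refine satGen_subset ⟨⟨fun _ => rfl, ?_, ?_, ?_⟩, ?_⟩ (by simp)
        · rintro a b c hab hbc
          exact Eq.trans hab hbc
        · rintro a b hab
          exact le_of_eq hab
        · rintro a b z hab hz
          obtain rfl : a = b := hab
          exact inf_eq_right.2 hz
        · rintro a b c hab hbc hac
          obtain rfl : a = c := hac
          exact le_antisymm hbc hab
      · rintro ⟨a, b⟩ hab
        obtain rfl : a = b := hab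
        exact hT.1.1 a
    | insert q F _ ih =>
      intro hq hF
      have hqc := hq q (Finset.mem_insert_self q F)
      have hFT : (F : Set (L × L)) ⊆ T := fun r hr => (hq r (Finset.mem_insert_of_mem hr)).2
      have hc := isSaturatedTS_coverSat hqc.1
      have hsF := isSaturatedTS_satGen hT hFT
      have hsub : coverSat q.1 q.2 ∪ satGen (F : Set (L × L)) ⊆ T :=
        Set.union_subset (coverSat_subset hT.1 hqc.2) (satGen_subset hT hFT)
      have hu : T = satGen (coverSat q.1 q.2 ∪ satGen (F : Set (L × L))) := by
        refine Set.Subset.antisymm ?_ (satGen_subset hT hsub)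
        conv_lhs => rw [hF]
        refine satGen_subset (isSaturatedTS_satGen hT hsub) fun r hr => subset_satGen _ ?_
        rcases Finset.mem_insert.1 (Finset.mem_coe.1 hr) with rfl | hr
        · exact Or.inl (mem_coverSat hqc.1.le)
        · exact Or.inr (subset_satGen _ hr)
      rcases hJ.2 _ _ hc hsF hu with e | e
      · exact ⟨q.1, q.2, hqc.1, e⟩
      · exact ih (fun r hr => hq r (Finset.mem_insert_of_mem hr)) e
  have hfin : {q : L × L | q.1 ⋖ q.2 ∧ q ∈ T}.Finite := Set.toFinite _
  have hsub : {q : L × L | q.1 ⋖ q.2 ∧ q ∈ T} ⊆ T := fun q hq => hq.2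
  refine key hfin.toFinset (fun q hq => by simpa using hq) ?_
  rw [hfin.coe_toFinset]
  refine Set.Subset.antisymm ?_ (satGen_subset hT hsub)
  exact mem_of_forall_covBy_mem (isSaturatedTS_satGen hT hsub) hT
    fun a b hab h => subset_satGen _ ⟨hab, h⟩

theorem coverSat_injective {x y x' y' : L} (h : x ⋖ y) (h' : x' ⋖ y')
    (e : coverSat x y = coverSat x' y') : x = x' ∧ y = y' := by
  have h₁ : (x, y) ∈ coverSat x' y' := e ▸ mem_coverSat h.le
  have h₂ : (x', y') ∈ coverSat x y := e ▸ mem_coverSat h'.le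
  obtain ⟨hy, hx⟩ := h₁.resolve_left h.ne
  obtain ⟨hy', -⟩ := h₂.resolve_left h'.ne
  obtain rfl : y = y' := le_antisymm hy hy'
  exact ⟨hx.trans (inf_eq_left.2 h'.le), rfl⟩

theorem card_joinIrredSat_eq_card_covBy (L : Type*) [Lattice L] [Finite L] [IsModularLattice L] :
    Nat.card {T : Set (L × L) // IsSaturatedTS T ∧ JoinIrredSat T} =
      Nat.card {q : L × L // q.1 ⋖ q.2} := by
  refine (Nat.card_eq_of_bijective (fun q : {q : L × L // q.1 ⋖ q.2} =>
    (⟨coverSat q.1.1 q.1.2, isSaturatedTS_coverSat q.2, joinIrredSat_coverSat q.2⟩ :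
      {T : Set (L × L) // IsSaturatedTS T ∧ JoinIrredSat T})) ⟨?_, ?_⟩).symm
  · rintro ⟨⟨x, y⟩, h⟩ ⟨⟨x', y'⟩, h'⟩ e
    obtain ⟨rfl, rfl⟩ := coverSat_injective h h' (Subtype.ext_iff.1 e)
    rfl
  · rintro ⟨T, hT, hJ⟩
    obtain ⟨x, y, h, rfl⟩ := exists_eq_coverSat_of_joinIrredSat hT hJ
    exact ⟨⟨(x, y), h⟩, rfl⟩

end PrincipalSaturated

section SubspaceCount

variable {K V : Type*} [Field K] [AddCommGroup V] [Module K V]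

theorem nonempty_submodule_orderIso_dual (K V : Type*) [Field K] [AddCommGroup V] [Module K V]
    [FiniteDimensional K V] : Nonempty (Submodule K V ≃o (Submodule K V)ᵒᵈ) :=
  ⟨Subspace.orderIsoFiniteDimensional.trans
    (Submodule.orderIsoMapComap (Module.finBasis K V).toDualEquiv.symm).dual⟩

theorem nonempty_covBy_equiv_atom_le [FiniteDimensional K V] (W : Submodule K V) :
    Nonempty ({U : Submodule K V // U ⋖ W} ≃ {A : Submodule K V // IsAtom A ∧ A ≤ W}) := by
  obtain ⟨d⟩ := nonempty_submodule_orderIso_dual K W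
  let e : Submodule K W ≃o Set.Iic W := W.mapIic
  have h₁ : {U : Submodule K V // U ⋖ W} ≃ {c : Set.Iic W // IsCoatom c} :=
    { toFun U := ⟨⟨U.1, U.2.le⟩, Set.Iic.isCoatom_iff.2 U.2⟩
      invFun c := ⟨c.1.1, Set.Iic.isCoatom_iff.1 c.2⟩
      left_inv _ := rfl
      right_inv _ := rfl }
  have h₂ : {c : Submodule K W // IsCoatom c} ≃ {c : Set.Iic W // IsCoatom c} :=
    e.toEquiv.subtypeEquiv fun c => (e.isCoatom_iff c).symm
  have h₃ : {c : Submodule K W // IsCoatom c} ≃ {a : Submodule K W // IsAtom a} :=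
    (d.toEquiv.trans OrderDual.ofDual).subtypeEquiv fun c => by
      rw [← d.isCoatom_iff c, ← isCoatom_dual_iff_isAtom]
      rfl
  have h₄ : {a : Submodule K W // IsAtom a} ≃ {a : Set.Iic W // IsAtom a} :=
    e.toEquiv.subtypeEquiv fun a => (e.isAtom_iff a).symm
  have h₅ : {a : Set.Iic W // IsAtom a} ≃ {A : Submodule K V // IsAtom A ∧ A ≤ W} :=
    { toFun a := ⟨a.1.1, a.2.of_isAtom_coe_Iic, a.1.2⟩
      invFun A := ⟨⟨A.1, A.2.2⟩, A.2.1.Iic A.2.2⟩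
      left_inv _ := rfl
      right_inv _ := rfl }
  exact ⟨h₁.trans (h₂.symm.trans (h₃.trans (h₄.trans h₅)))⟩

theorem card_Ici_of_isAtom [FiniteDimensional K V] {A : Submodule K V} (hA : IsAtom A) :
    Nat.card {W : Submodule K V // A ≤ W} =
      Nat.card (Submodule K (Fin (Module.finrank K V - 1) → K)) := by
  have hA₁ : Module.finrank K A = 1 := Submodule.isAtom_iff_finrank_eq_one.1 hA
  have hq := A.finrank_quotient_add_finrank
  have e : (V ⧸ A) ≃ₗ[K] (Fin (Module.finrank K V - 1) → K) :=
    LinearEquiv.ofFinrankEq _ _ (by rw [Module.finrank_fin_fun]; omega)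
  exact Nat.card_congr
    (A.comapMkQRelIso.symm.toEquiv.trans (Submodule.orderIsoMapComap e).toEquiv)

theorem card_isAtom_submodule [Finite K] [FiniteDimensional K V] :
    Nat.card {A : Submodule K V // IsAtom A} =
      ∑ i ∈ Finset.range (Module.finrank K V), Nat.card K ^ i := by
  rw [← Projectivization.card_of_finrank K V rfl]
  exact Nat.card_congr ((Equiv.subtypeEquivRight fun A =>
    Submodule.isAtom_iff_finrank_eq_one).trans (Projectivization.equivSubmodule K V).symm)

theorem card_covBy_submodule [Finite K] [FiniteDimensional K V] :
    Nat.card {q : Submodule K V × Submodule K V // q.1 ⋖ q.2} =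
      (∑ i ∈ Finset.range (Module.finrank K V), Nat.card K ^ i) *
        Nat.card (Submodule K (Fin (Module.finrank K V - 1) → K)) := by
  have : Finite V := Module.finite_of_finite K
  have : Fintype {A : Submodule K V // IsAtom A} := Fintype.ofFinite _
  have e₁ : {q : Submodule K V × Submodule K V // q.1 ⋖ q.2} ≃
      Σ W : Submodule K V, {A : Submodule K V // IsAtom A ∧ A ≤ W} :=
    { toFun q := ⟨q.1.2, (nonempty_covBy_equiv_atom_le q.1.2).some ⟨q.1.1, q.2⟩⟩
      invFun s := ⟨(((nonempty_covBy_equiv_atom_le s.1).some.symm s.2).1, s.1),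
        ((nonempty_covBy_equiv_atom_le s.1).some.symm s.2).2⟩
      left_inv q := by simp
      right_inv s := by simp }
  have e₂ : (Σ W : Submodule K V, {A : Submodule K V // IsAtom A ∧ A ≤ W}) ≃
      Σ A : {A : Submodule K V // IsAtom A}, {W : Submodule K V // A.1 ≤ W} :=
    { toFun s := ⟨⟨s.2.1, s.2.2.1⟩, ⟨s.1, s.2.2.2⟩⟩
      invFun s := ⟨s.2.1, ⟨s.1.1, s.1.2, s.2.2⟩⟩
      left_inv _ := rfl
      right_inv _ := rfl }
  rw [Nat.card_congr (e₁.trans e₂), Nat.card_sigma,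
    Finset.sum_congr rfl fun A _ => card_Ici_of_isAtom A.2, Finset.sum_const, Finset.card_univ,
    ← Nat.card_eq_fintype_card, card_isAtom_submodule, smul_eq_mul]

end SubspaceCount

/-- The number of join-irreducible elements of `Sat(Sub(C_p^n))` equals
`((p^n − 1)/(p − 1)) · a_{n−1,p}`. -/
theorem card_joinIrred_sat (p n : ℕ) (hp : p.Prime) (hn : 0 < n) :
    Nat.card {T : Set (AddSubgroup (Fin n → ZMod p) × AddSubgroup (Fin n → ZMod p)) //
        IsSaturatedTS T ∧ JoinIrredSat T} =
      ((p ^ n - 1) / (p - 1)) * numSubspaces p (n - 1) := by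
  have : Fact p.Prime := ⟨hp⟩
  let e : AddSubgroup (Fin n → ZMod p) ≃o Submodule (ZMod p) (Fin n → ZMod p) :=
    AddSubgroup.toZModSubmodule p
  have hcov : Nat.card {q : AddSubgroup (Fin n → ZMod p) × AddSubgroup (Fin n → ZMod p) //
        q.1 ⋖ q.2} = Nat.card {q : Submodule (ZMod p) (Fin n → ZMod p) ×
        Submodule (ZMod p) (Fin n → ZMod p) // q.1 ⋖ q.2} :=
    Nat.card_congr ((e.toEquiv.prodCongr e.toEquiv).subtypeEquiv fun q =>
      (apply_covBy_apply_iff e).symm)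
  rw [card_joinIrredSat_eq_card_covBy, hcov, card_covBy_submodule, Module.finrank_fin_fun,
    Nat.card_zmod, Nat.geomSum_eq hp.two_le, numSubspaces]
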